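/- Let (a_n)_{n≥1} be a sequence of distinct positive real numbers such that inf_{1≤m≠n≤N} |a_m − a_n| ≥ c for all N, where c is a positive constant, and let ε > 0. Then for almost all α ∈ [0,1] there exists N₀(α) such that for all N ≥ N₀(α), δ_min^α(N) ≥ max(1, c) / (D_N · log N · (log₂ N)^{1+ε}). -/

import Mathlib

open MeasureTheory Filter

/-- Distance from a real number to the nearest integer. -/
noncomputable def nint (x : ℝ) : ℝ := |x - round x|

/-- `deltaMin a α N` is the minimal gap
`min { ‖α (a_m − a_n)‖ : 1 ≤ m ≠ n ≤ N }`. -/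
noncomputable def deltaMin (a : ℕ → ℝ) (α : ℝ) (N : ℕ) : ℝ :=
  sInf {d : ℝ | ∃ m n : ℕ, 1 ≤ m ∧ m ≤ N ∧ 1 ≤ n ∧ n ≤ N ∧ m ≠ n ∧
    d = nint (α * (a m - a n))}

/-- `Dcard a N` is the number of distinct positive differences
`#{ |a_m − a_n| : 1 ≤ m ≠ n ≤ N }`. -/
noncomputable def Dcard (a : ℕ → ℝ) (N : ℕ) : ℕ :=
  Set.ncard {x : ℝ | ∃ m n : ℕ, 1 ≤ m ∧ m ≤ N ∧ 1 ≤ n ∧ n ≤ N ∧ m ≠ n ∧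
    x = |a m - a n|}

/-- `Log x = max (1, log x)`. -/
noncomputable def Log (x : ℝ) : ℝ := max 1 (Real.log x)

/-- Iterated logarithm `log₂ x = Log (Log x)`. -/
noncomputable def Log2 (x : ℝ) : ℝ := Log (Log x)

theorem nint_neg (x : ℝ) : nint (-x) = nint x := by
  have key : ∀ y : ℝ, nint (-y) ≤ nint y := fun y ↦ by
    have h := round_le (-y) (-round y)
    rwa [Int.cast_neg, ← neg_sub', abs_neg] at h
  exact le_antisymm (key x) (by simpa using key (-x))

theorem one_le_Log (x : ℝ) : 1 ≤ Log x := le_max_left _ _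

theorem Log_le_Log {x y : ℝ} (hx : 0 < x) (hxy : x ≤ y) : Log x ≤ Log y :=
  max_le_max le_rfl (Real.log_le_log hx hxy)

/-- The points of `[0, 1]` at which a dilation by `x` comes close to an integer have small
measure. -/
theorem volume_nint_mul_lt_le {c x η : ℝ} (hc : 0 < c) (hx : c ≤ x) (hη : 0 ≤ η) :
    volume.restrict (Set.Icc (0 : ℝ) 1) {α | nint (α * x) < η} ≤
      ENNReal.ofReal ((2 + 4 / c) * η) := by
  have hx0 : 0 < x := hc.trans_le hx
  have hsub : {α | nint (α * x) < η} ∩ Set.Icc (0 : ℝ) 1 ⊆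
      ⋃ k ∈ Finset.range (⌈x⌉₊ + 1), Set.Icc (((k : ℝ) - η) / x) ((k + η) / x) := by
    rintro α ⟨hα, h0, h1⟩
    have hα' : |α * x - round (α * x)| < η := hα
    have hr := abs_le.1 (abs_sub_round (α * x))
    have hy0 : 0 ≤ α * x := by positivity
    have hy1 : α * x ≤ x := by nlinarith
    have hk0 : 0 ≤ round (α * x) := by
      have : (-1 : ℝ) < round (α * x) := by linarith [hr.2]
      have : (-1 : ℤ) < round (α * x) := by exact_mod_cast this
      omega
    obtain ⟨k, hk⟩ := Int.eq_ofNat_of_zero_le hk0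
    rw [hk] at hα' hr
    push_cast at hα' hr
    rw [abs_lt] at hα'
    simp only [Set.mem_iUnion, Finset.mem_range]
    refine ⟨k, ?_, ?_⟩
    · have : (k : ℝ) < (⌈x⌉₊ : ℝ) + 1 := by linarith [hr.1, Nat.le_ceil x]
      exact_mod_cast this
    · rw [Set.mem_Icc, div_le_iff₀ hx0, le_div_iff₀ hx0]
      constructor <;> linarith
  rw [Measure.restrict_apply' measurableSet_Icc]
  calc _ ≤ _ := measure_mono hsub
    _ ≤ ∑ k ∈ Finset.range (⌈x⌉₊ + 1),
        volume (Set.Icc (((k : ℝ) - η) / x) ((k + η) / x)) := measure_biUnion_finset_le _ _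
    _ = ∑ k ∈ Finset.range (⌈x⌉₊ + 1), ENNReal.ofReal (2 * η / x) := by
        refine Finset.sum_congr rfl fun k _ ↦ ?_
        rw [Real.volume_Icc]
        congr 1
        ring
    _ = ENNReal.ofReal ((⌈x⌉₊ + 1) * (2 * η / x)) := by
        rw [Finset.sum_const, Finset.card_range, nsmul_eq_mul,
          ENNReal.ofReal_mul (by positivity)]
        congr 1
        rw [← Nat.cast_one (R := ℝ), ← Nat.cast_add, ENNReal.ofReal_natCast]
    _ ≤ _ := by
        apply ENNReal.ofReal_le_ofReal
        have h1 : (⌈x⌉₊ : ℝ) + 1 ≤ x + 2 := by linarith [Nat.ceil_lt_add_one hx0.le]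
        calc ((⌈x⌉₊ : ℝ) + 1) * (2 * η / x) ≤ (x + 2) * (2 * η / x) := by gcongr
          _ = (2 + 4 / x) * η := by field_simp; ring
          _ ≤ _ := by gcongr

/-- A version of the convergent series `∑ 1 / (j (log j) ^ (1 + ε))`. -/
theorem summable_one_div_mul_Log_rpow {ε : ℝ} (hε : 0 < ε) :
    Summable fun j : ℕ ↦ 1 / ((j / 4 : ℝ) * Log (j / 4) ^ (1 + ε)) := by
  have hL : ∀ x, 0 < Log x := fun x ↦ zero_lt_one.trans_le (one_le_Log x)
  rw [← summable_condensed_iff_of_nonneg]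
  · have hs : Summable fun k : ℕ ↦ 4 * 8 ^ (1 + ε) * (1 / ((k + 1 : ℕ) : ℝ) ^ (1 + ε)) :=
      (((summable_nat_add_iff 1).2
        (Real.summable_one_div_nat_rpow.2 (by linarith : 1 < 1 + ε)))).mul_left _
    refine hs.of_nonneg_of_le (fun k ↦ ?_) fun k ↦ ?_
    · have := hL (((2 ^ k : ℕ) : ℝ) / 4)
      positivity
    · have h8 : ((k + 1 : ℕ) : ℝ) / 8 ≤ Log (((2 ^ k : ℕ) : ℝ) / 4) := by
        rw [Log, le_max_iff]
        rcases le_or_gt k 7 with hk | hk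
        · left
          have : ((k + 1 : ℕ) : ℝ) ≤ 8 := by exact_mod_cast (by omega : k + 1 ≤ 8)
          linarith
        · right
          have hk' : (7 : ℝ) < k := by exact_mod_cast hk
          have h2 := Real.log_two_gt_d9
          have h4 : Real.log 4 = 2 * Real.log 2 := by
            rw [show (4 : ℝ) = 2 ^ 2 by norm_num, Real.log_pow]
            norm_num
          rw [Real.log_div (by positivity) (by norm_num), Nat.cast_pow, Nat.cast_ofNat,
            Real.log_pow, h4]
          push_cast
          nlinarith
      have hp : (((k + 1 : ℕ) : ℝ) / 8) ^ (1 + ε) ≤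
          Log (((2 ^ k : ℕ) : ℝ) / 4) ^ (1 + ε) := by gcongr
      rw [Real.div_rpow (by positivity) (by norm_num)] at hp
      calc (2 : ℝ) ^ k * (1 / (((2 ^ k : ℕ) : ℝ) / 4 * Log (((2 ^ k : ℕ) : ℝ) / 4) ^ (1 + ε)))
          = 4 * (1 / Log (((2 ^ k : ℕ) : ℝ) / 4) ^ (1 + ε)) := by
            have := hL (((2 ^ k : ℕ) : ℝ) / 4)
            push_cast at this ⊢
            field_simp
        _ ≤ 4 * (1 / (((k + 1 : ℕ) : ℝ) ^ (1 + ε) / 8 ^ (1 + ε))) := by gcongr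
        _ = _ := by field_simp
  · intro j
    have := hL ((j : ℝ) / 4)
    positivity
  · intro m n hm hmn
    have hm' : (0 : ℝ) < m := by exact_mod_cast hm
    have hmn' : (m : ℝ) ≤ n := by exact_mod_cast hmn
    have h1 := hL ((m : ℝ) / 4)
    have h2 : Log ((m : ℝ) / 4) ≤ Log ((n : ℝ) / 4) := Log_le_Log (by positivity) (by gcongr)
    gcongr

/-- The positive differences of the first `N` terms; `Dcard a N` is its cardinality. -/
def diffSet (a : ℕ → ℝ) (N : ℕ) : Set ℝ :=
  {x : ℝ | ∃ m n : ℕ, 1 ≤ m ∧ m ≤ N ∧ 1 ≤ n ∧ n ≤ N ∧ m ≠ n ∧ x = |a m - a n|}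

theorem diffSet_subset_image (a : ℕ → ℝ) (N : ℕ) :
    diffSet a N ⊆ ((Finset.Icc 1 N ×ˢ Finset.Icc 1 N).image
      fun p : ℕ × ℕ ↦ |a p.1 - a p.2| : Finset ℝ) := by
  rintro x ⟨m, n, hm, hmN, hn, hnN, -, rfl⟩
  simp only [Finset.coe_image, Set.mem_image, Finset.mem_coe, Finset.mem_product, Finset.mem_Icc]
  exact ⟨(m, n), ⟨⟨hm, hmN⟩, hn, hnN⟩, rfl⟩

theorem finite_diffSet (a : ℕ → ℝ) (N : ℕ) : (diffSet a N).Finite :=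
  (Finset.finite_toSet _).subset (diffSet_subset_image a N)

theorem diffSet_mono (a : ℕ → ℝ) : Monotone (diffSet a) := by
  rintro M N h x ⟨m, n, hm, hmN, hn, hnN, hne, rfl⟩
  exact ⟨m, n, hm, hmN.trans h, hn, hnN.trans h, hne, rfl⟩

theorem Dcard_le_sq (a : ℕ → ℝ) (N : ℕ) : Dcard a N ≤ N ^ 2 := by
  calc Dcard a N ≤ _ := Set.ncard_le_ncard (diffSet_subset_image a N) (Finset.finite_toSet _)
    _ ≤ _ := by
      rw [Set.ncard_coe_finset]
      exact Finset.card_image_le.trans (by simp [sq])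

theorem le_two_mul_Dcard_add_one {a : ℕ → ℝ}
    (ha : ∀ m n, 1 ≤ m → 1 ≤ n → m ≠ n → a m ≠ a n) (N : ℕ) : N ≤ 2 * Dcard a N + 1 := by
  classical
  let S : Finset ℝ := (finite_diffSet a N).toFinset
  have hS : S.card = Dcard a N := (Set.ncard_eq_toFinset_card _ _).symm
  have hmaps : (Finset.Icc 1 N).image a ⊆
      insert (a 1) (S.image (fun d ↦ a 1 + d) ∪ S.image (fun d ↦ a 1 - d)) := by
    intro y hy
    obtain ⟨m, hm, rfl⟩ := Finset.mem_image.1 hy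
    rw [Finset.mem_Icc] at hm
    rcases eq_or_ne m 1 with rfl | hne
    · exact Finset.mem_insert_self _ _
    · have hd : |a m - a 1| ∈ S :=
        (Set.Finite.mem_toFinset _).2 ⟨m, 1, hm.1, hm.2, le_rfl, hm.1.trans hm.2, hne, rfl⟩
      refine Finset.mem_insert_of_mem (Finset.mem_union.2 ?_)
      rcases abs_choice (a m - a 1) with h | h
      · exact .inl (Finset.mem_image.2 ⟨_, hd, by rw [h]; ring⟩)
      · exact .inr (Finset.mem_image.2 ⟨_, hd, by rw [h]; ring⟩)
  have hinj : ((Finset.Icc 1 N).image a).card = N := by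
    rw [Finset.card_image_of_injOn, Nat.card_Icc, Nat.add_sub_cancel]
    intro m hm n hn h
    by_contra hne
    exact ha m n (Finset.mem_Icc.1 hm).1 (Finset.mem_Icc.1 hn).1 hne h
  have h1 := Finset.card_le_card hmaps
  have h2 := Finset.card_insert_le (a 1)
    (S.image (fun d ↦ a 1 + d) ∪ S.image (fun d ↦ a 1 - d))
  have h3 := Finset.card_union_le (S.image (fun d ↦ a 1 + d)) (S.image (fun d ↦ a 1 - d))
  have h4 : (S.image (fun d ↦ a 1 + d)).card ≤ _ := Finset.card_image_le
  have h5 : (S.image (fun d ↦ a 1 - d)).card ≤ _ := Finset.card_image_le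
  omega

/-- All differences occurring while `Dcard a N < K` occur simultaneously for one such `N`. -/
theorem exists_diffSet_subset {a : ℕ → ℝ}
    (ha : ∀ m n, 1 ≤ m → 1 ≤ n → m ≠ n → a m ≠ a n) {K : ℕ} (hK : 0 < K) :
    ∃ M, Dcard a M < K ∧ ∀ N, Dcard a N < K → diffSet a N ⊆ diffSet a M := by
  have hne : {N | Dcard a N < K}.Nonempty :=
    ⟨0, (Dcard_le_sq a 0).trans_lt (by simpa using hK)⟩
  have hbdd : BddAbove {N | Dcard a N < K} := by
    refine ⟨2 * K + 1, fun N hN ↦ ?_⟩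
    have := le_two_mul_Dcard_add_one ha N
    have : Dcard a N < K := hN
    omega
  exact ⟨_, Nat.sSup_mem hne hbdd, fun N hN ↦ diffSet_mono a (le_csSup hbdd hN)⟩

/-- On the dyadic range `2 ^ j ≤ D ≤ N ^ 2` the threshold is controlled by a function of `j`. -/
theorem div_mul_Log_le {ε M : ℝ} (hε : 0 < ε) (hM : 0 ≤ M) {j D N : ℕ} (hj : 0 < j)
    (hjD : 2 ^ j ≤ D) (hDN : D ≤ N ^ 2) :
    M / ((D : ℝ) * Log (N : ℝ) * Log2 (N : ℝ) ^ (1 + ε)) ≤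
      M / 2 ^ j * (1 / ((j / 4 : ℝ) * Log (j / 4) ^ (1 + ε))) := by
  have hj' : (0 : ℝ) < j := by exact_mod_cast hj
  have hD : (2 : ℝ) ^ j ≤ D := by exact_mod_cast hjD
  have hN : (2 : ℝ) ^ j ≤ (N : ℝ) ^ 2 := by exact_mod_cast hjD.trans hDN
  have hlog : (j / 4 : ℝ) ≤ Log N := by
    refine le_trans ?_ (le_max_right _ _)
    have h := Real.log_le_log (by positivity) hN
    rw [Real.log_pow, Real.log_pow] at h
    push_cast at h
    nlinarith [Real.log_two_gt_d9]
  have hlog2 : Log (j / 4) ≤ Log2 N := Log_le_Log (by positivity) hlog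
  have h1 : 0 < Log (j / 4) := zero_lt_one.trans_le (one_le_Log _)
  have h2 : 0 ≤ Log N := zero_le_one.trans (one_le_Log _)
  rw [div_mul_div_comm, mul_one, mul_assoc]
  gcongr

theorem stmt10 (a : ℕ → ℝ) (c : ℝ) (hc : 0 < c)
    (hpos : ∀ n, 1 ≤ n → 0 < a n)
    (hdist : ∀ m n, 1 ≤ m → 1 ≤ n → m ≠ n → a m ≠ a n)
    (hsep : ∀ m n, 1 ≤ m → 1 ≤ n → m ≠ n → c ≤ |a m - a n|)
    (ε : ℝ) (hε : 0 < ε) :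
    ∀ᵐ α ∂(volume.restrict (Set.Icc (0:ℝ) 1)),
      ∃ N₀ : ℕ, ∀ N, N₀ ≤ N →
        max 1 c / ((Dcard a N : ℝ) * Log (N : ℝ) * Log2 (N : ℝ) ^ (1 + ε)) ≤
          deltaMin a α N := by
  set M : ℝ := max 1 c
  have hM : 0 ≤ M := zero_le_one.trans (le_max_left _ _)
  let f : ℕ → ℝ := fun j ↦ 1 / ((j / 4 : ℝ) * Log (j / 4) ^ (1 + ε))
  have hf0 : ∀ j, 0 ≤ f j := fun j ↦ by
    have : 0 < Log (j / 4) := zero_lt_one.trans_le (one_le_Log _)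
    positivity
  have hf : Summable f := summable_one_div_mul_Log_rpow hε
  choose L hLcard hLsub using fun j : ℕ ↦ exists_diffSet_subset hdist (K := 2 ^ (j + 1)) (by simp)
  let s : ℕ → Set ℝ := fun j ↦ ⋃ x ∈ (finite_diffSet a (L j)).toFinset,
    {α | nint (α * x) < M / 2 ^ j * f j}
  have hs : ∀ j, volume.restrict (Set.Icc (0 : ℝ) 1) (s j) ≤
      ENNReal.ofReal (2 * (2 + 4 / c) * M * f j) := fun j ↦ by
    have hfj := hf0 j
    calc _ ≤ _ := measure_biUnion_finset_le _ _
      _ ≤ ∑ x ∈ (finite_diffSet a (L j)).toFinset,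
          ENNReal.ofReal ((2 + 4 / c) * (M / 2 ^ j * f j)) := by
        refine Finset.sum_le_sum fun x hx ↦ volume_nint_mul_lt_le hc ?_ (by positivity)
        obtain ⟨m, n, hm, -, hn, -, hne, rfl⟩ := (Set.Finite.mem_toFinset _).1 hx
        exact hsep m n hm hn hne
      _ = ENNReal.ofReal (Dcard a (L j) * ((2 + 4 / c) * (M / 2 ^ j * f j))) := by
        rw [Finset.sum_const, nsmul_eq_mul, ENNReal.ofReal_mul (Nat.cast_nonneg _),
          ENNReal.ofReal_natCast, ← Set.ncard_eq_toFinset_card _ (finite_diffSet a (L j))]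
        rfl
      _ ≤ _ := by
        apply ENNReal.ofReal_le_ofReal
        have hle : (Dcard a (L j) : ℝ) ≤ 2 ^ (j + 1) := by exact_mod_cast (hLcard j).le
        calc _ ≤ (2 : ℝ) ^ (j + 1) * ((2 + 4 / c) * (M / 2 ^ j * f j)) := by gcongr
          _ = _ := by
            rw [pow_succ]
            field_simp
  have hsum : ∑' j, volume.restrict (Set.Icc (0 : ℝ) 1) (s j) ≠ ⊤ :=
    ne_top_of_le_ne_top (hf.mul_left _).tsum_ofReal_ne_top (ENNReal.tsum_le_tsum hs)
  filter_upwards [ae_eventually_notMem hsum] with α hα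
  obtain ⟨J, hJ⟩ := eventually_atTop.1 hα
  refine ⟨2 * 2 ^ (J + 1) + 2, fun N hN ↦ ?_⟩
  have hD : 2 ^ (J + 1) ≤ Dcard a N := by
    have := le_two_mul_Dcard_add_one hdist N
    omega
  have hD0 : Dcard a N ≠ 0 := ((Nat.two_pow_pos _).trans_le hD).ne'
  set j := Nat.log 2 (Dcard a N) with hj
  have hJj : J + 1 ≤ j := Nat.le_log_of_pow_le one_lt_two hD
  refine (div_mul_Log_le hε hM (by omega) (Nat.pow_log_le_self 2 hD0) (Dcard_le_sq a N)).trans ?_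
  refine le_csInf ⟨_, 1, 2, le_rfl, by omega, by omega, by omega, by omega, rfl⟩ ?_
  rintro d ⟨m, n, hm, hmN, hn, hnN, hne, rfl⟩
  have hmem : |a m - a n| ∈ diffSet a (L j) :=
    hLsub j N (Nat.lt_pow_succ_log_self one_lt_two _) ⟨m, n, hm, hmN, hn, hnN, hne, rfl⟩
  have hnot := hJ j (by omega)
  simp only [s, Set.mem_iUnion, not_exists, Set.Finite.mem_toFinset, Set.mem_ofPred_eq,
    not_lt] at hnot
  refine (hnot _ hmem).trans_eq ?_
  rcases abs_choice (a m - a n) with h | h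
  · rw [h]
  · rw [h, mul_neg, nint_neg]
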